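/- For every θ ∈ ℝ, the symbol of the LW5 scheme satisfies Re(−e^{−3iθ}/30 + e^{−2iθ}/4 − e^{−iθ} + 1/3 + e^{iθ}/2 − e^{2iθ}/20) = (2/15)(1 − cos θ)³. In particular this real part is nonnegative, so for any b ≥ 0 and Δv > 0 the eigenvalues −b μ of the semidiscrete mode equations ∂_t ū = −b μ ū, with μ = (1/Δv)(−e^{−3iθ}/30 + e^{−2iθ}/4 − e^{−iθ} + 1/3 + e^{iθ}/2 − e^{2iθ}/20), all lie in the closed left half of the complex plane: the upwind discretization is diffusive and moves the eigenvalues off the imaginary axis into the left half plane. -/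

import Mathlib

/-- The real part of the LW5 symbol at phase angle `θ`. -/
theorem lw5_symbol_re (θ : ℝ) :
    (-Complex.exp (-3 * Complex.I * (θ : ℂ)) / 30
      + Complex.exp (-2 * Complex.I * (θ : ℂ)) / 4
      - Complex.exp (-Complex.I * (θ : ℂ))
      + 1 / 3
      + Complex.exp (Complex.I * (θ : ℂ)) / 2
      - Complex.exp (2 * Complex.I * (θ : ℂ)) / 20).re
      = (2 / 15) * (1 - Real.cos θ) ^ 3 := by
  have h3 : -3 * Complex.I * (θ : ℂ) = ((-(3 * θ) : ℝ) : ℂ) * Complex.I := by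
    push_cast; ring
  have h2 : -2 * Complex.I * (θ : ℂ) = ((-(2 * θ) : ℝ) : ℂ) * Complex.I := by
    push_cast; ring
  have h1 : -Complex.I * (θ : ℂ) = ((-θ : ℝ) : ℂ) * Complex.I := by
    push_cast; ring
  have h1' : Complex.I * (θ : ℂ) = (θ : ℂ) * Complex.I := by ring
  have h2' : 2 * Complex.I * (θ : ℂ) = ((2 * θ : ℝ) : ℂ) * Complex.I := by
    push_cast; ring
  rw [h3, h2, h1, h1', h2']
  simp only [Complex.add_re, Complex.sub_re, Complex.neg_re, Complex.div_ofNat_re,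
    Complex.one_re, Complex.exp_ofReal_mul_I_re, Real.cos_neg, Real.cos_two_mul,
    Real.cos_three_mul]
  ring

/-- The real part of the LW5 symbol equals `(2/15)(1 − cos θ)³ ≥ 0`; consequently the
eigenvalues `−b μ` of the semidiscrete mode equations (for `b ≥ 0`, `Δv > 0`) all lie in the
closed left half-plane. -/
theorem stmt_13 :
    (∀ θ : ℝ,
      (-Complex.exp (-3 * Complex.I * (θ : ℂ)) / 30
        + Complex.exp (-2 * Complex.I * (θ : ℂ)) / 4
        - Complex.exp (-Complex.I * (θ : ℂ))
        + 1 / 3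
        + Complex.exp (Complex.I * (θ : ℂ)) / 2
        - Complex.exp (2 * Complex.I * (θ : ℂ)) / 20).re
        = (2 / 15) * (1 - Real.cos θ)^3)
    ∧ (∀ θ b Δv : ℝ, 0 ≤ b → 0 < Δv →
        (-(b : ℂ) * ((1 / (Δv : ℂ)) *
          (-Complex.exp (-3 * Complex.I * (θ : ℂ)) / 30
            + Complex.exp (-2 * Complex.I * (θ : ℂ)) / 4
            - Complex.exp (-Complex.I * (θ : ℂ))
            + 1 / 3
            + Complex.exp (Complex.I * (θ : ℂ)) / 2
            - Complex.exp (2 * Complex.I * (θ : ℂ)) / 20))).re ≤ 0) := by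
  refine ⟨lw5_symbol_re, fun θ b Δv hb hv => ?_⟩
  rw [← mul_assoc, show -(b : ℂ) * (1 / (Δv : ℂ)) = ((-(b / Δv) : ℝ) : ℂ) by
    push_cast; ring, Complex.re_ofReal_mul, lw5_symbol_re]
  have hcos : 0 ≤ 1 - Real.cos θ := sub_nonneg.mpr (Real.cos_le_one θ)
  rw [neg_mul, neg_nonpos]
  positivity
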